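/- Let k be a field of characteristic p > 0, m = pm' ≥ 5 a multiple of p, with either p odd, or p = 2 and m' even. Let W = k^m with basis e₁,…,e_m on which S_m acts by permuting basis vectors, Ṽ = ⟨e_i - e_j : 1 ≤ i < j ≤ m⟩, v = Σ_{i=1}^m e_i, V = Ṽ/⟨v⟩ (of dimension m-2), v_j = Σ_{i=1}^p e_{p(j-1)+i}, w = Σ_{i=1}^m i·e_i ∈ Ṽ, and let U ⊆ V be the image of ⟨v₁,…,v_{m'}⟩ + ⟨w⟩. Set σ = (1,2,…,p)(p+1,…,2p)⋯((m'-1)p+1,…,m) ∈ S_m. Then the point stabilizer of U in S_m acting on V is the cyclic group ⟨σ⟩ of order p, the fixed-point space of σ on V equals U, and U has codimension (p-1)m' - 2 > 1 in V, so σ is not a pseudo-reflection. -/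

import Mathlib

open Matrix

section SymmetricSetup

variable (k : Type) [Field k] (m : ℕ)

/-- The standard basis vector `e i` of `W = k^m`. -/
def stdVec (i : Fin m) : Fin m → k := Pi.single i 1

/-- The submodule `Ṽ = ⟨e_i - e_j : 1 ≤ i < j ≤ m⟩` of `W`. -/
def Vtil : Submodule k (Fin m → k) :=
  Submodule.span k {x | ∃ i j : Fin m, i < j ∧ x = stdVec k m i - stdVec k m j}

/-- `v = Σ_{i=1}^m e_i`. -/
def vvec : Fin m → k := ∑ i, stdVec k m i

/-- The action of a permutation on `W = k^m`, permuting the basis vectors: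
`e_i ↦ e_{σ i}`, i.e. `(σ • w) j = w (σ⁻¹ j)`. -/
def permT (σ : Equiv.Perm (Fin m)) : (Fin m → k) →ₗ[k] (Fin m → k) :=
  LinearMap.funLeft k k ⇑σ.symm

lemma permT_stdVec (σ : Equiv.Perm (Fin m)) (i : Fin m) :
    permT k m σ (stdVec k m i) = stdVec k m (σ i) := by
  ext j
  simp [permT, stdVec, LinearMap.funLeft, Pi.single_apply, Equiv.symm_apply_eq]

lemma stdVec_sub_mem (a b : Fin m) : stdVec k m a - stdVec k m b ∈ Vtil k m := by
  rcases lt_trichotomy a b with h | h | h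
  · exact Submodule.subset_span ⟨a, b, h, rfl⟩
  · simp [h, sub_self, Submodule.zero_mem]
  · have : stdVec k m b - stdVec k m a ∈ Vtil k m :=
      Submodule.subset_span ⟨b, a, h, rfl⟩
    simpa using Submodule.neg_mem _ this

lemma permT_mem_Vtil (σ : Equiv.Perm (Fin m)) :
    ∀ x ∈ Vtil k m, permT k m σ x ∈ Vtil k m := by
  intro x hx
  induction hx using Submodule.span_induction with
  | mem x hx =>
    obtain ⟨i, j, _, rfl⟩ := hx
    rw [map_sub, permT_stdVec, permT_stdVec]
    exact stdVec_sub_mem k m _ _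
  | zero => simp [Submodule.zero_mem]
  | add x y _ _ hx hy => rw [map_add]; exact Submodule.add_mem _ hx hy
  | smul c x _ hx => rw [_root_.map_smul]; exact Submodule.smul_mem _ _ hx

lemma permT_vvec (σ : Equiv.Perm (Fin m)) : permT k m σ (vvec k m) = vvec k m := by
  rw [vvec, map_sum]
  simp_rw [permT_stdVec]
  exact Equiv.sum_comp σ (stdVec k m)

/-- The submodule `⟨v⟩` of `Ṽ`. -/
def Zv : Submodule k (Vtil k m) :=
  Submodule.span k {x : Vtil k m | (x : Fin m → k) = vvec k m}

/-- The `S_m`-representation `V = Ṽ/⟨v⟩`. -/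
abbrev Vquot := Vtil k m ⧸ Zv k m

/-- The induced action of a permutation on `V = Ṽ/⟨v⟩`. -/
def rho (σ : Equiv.Perm (Fin m)) : Vquot k m →ₗ[k] Vquot k m :=
  Submodule.mapQ (Zv k m) (Zv k m)
    ((permT k m σ).restrict (permT_mem_Vtil k m σ))
    (by
      rw [Zv, Submodule.span_le]
      intro x hx
      refine Submodule.subset_span ?_
      show (((permT k m σ).restrict (permT_mem_Vtil k m σ) x : Vtil k m) : Fin m → k)
        = vvec k m
      rw [LinearMap.restrict_coe_apply]
      rw [show (x : Fin m → k) = vvec k m from hx]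
      exact permT_vvec k m σ)

end SymmetricSetup

/-- `v_j = Σ_{i=1}^p e_{p(j-1)+i}`, the sum of the basis vectors in the `j`-th
block of size `p`. -/
def vj (k : Type) [Field k] (p m' : ℕ) (j : Fin m') : Fin (p * m') → k :=
  ∑ i : Fin p, stdVec k (p * m')
    ⟨p * (j : ℕ) + (i : ℕ), by
      have h1 := i.isLt
      have h2 : (j : ℕ) + 1 ≤ m' := j.isLt
      have h3 : p * ((j : ℕ) + 1) ≤ p * m' := Nat.mul_le_mul_left p h2
      rw [Nat.mul_succ] at h3
      omega⟩

/-- `w = Σ_{i=1}^m i·e_i`. -/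
def wvec (k : Type) [Field k] (m : ℕ) : Fin m → k :=
  ∑ i : Fin m, (((i : ℕ) + 1 : ℕ) : k) • stdVec k m i

/-- `U`, the image in `V = Ṽ/⟨v⟩` of `⟨v₁,…,v_{m'}⟩ + ⟨w⟩`. -/
def Usub (k : Type) [Field k] (p m' : ℕ) : Submodule k (Vquot k (p * m')) :=
  Submodule.map (Zv k (p * m')).mkQ
    (Submodule.span k
      {x : Vtil k (p * m') |
        (∃ j : Fin m', (x : Fin (p * m') → k) = vj k p m' j) ∨
        (x : Fin (p * m') → k) = wvec k (p * m')})

/-- The permutation `σ = (1,2,…,p)(p+1,…,2p)⋯((m'-1)p+1,…,m)`, rotating each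
of the `m'` consecutive blocks of size `p` cyclically. -/
def blockCycle (p m' : ℕ) : Equiv.Perm (Fin (p * m')) :=
  (finCongr (Nat.mul_comm m' p)).permCongr
    ((finProdFinEquiv.symm.trans
      ((Equiv.refl (Fin m')).prodCongr (finRotate p))).trans finProdFinEquiv)

section Quotient

variable {k : Type} [Field k] {m : ℕ}

lemma vvec_apply (i : Fin m) : vvec k m i = 1 := by
  simp [vvec, stdVec, Finset.sum_apply, Pi.single_apply]

lemma wvec_apply (i : Fin m) : wvec k m i = (i : ℕ) + 1 := by
  simp [wvec, stdVec, Finset.sum_apply, Pi.single_apply]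

lemma permT_apply (τ : Equiv.Perm (Fin m)) (x : Fin m → k) (i : Fin m) :
    permT k m τ x (τ i) = x i := by
  simp [permT, LinearMap.funLeft]

/-- `Ṽ` is the hyperplane of vectors with coordinate sum zero. -/
lemma mem_Vtil_iff (x : Fin m → k) : x ∈ Vtil k m ↔ ∑ i, x i = 0 := by
  constructor
  · intro hx
    induction hx using Submodule.span_induction with
    | mem x hx =>
      obtain ⟨i, j, _, rfl⟩ := hx
      simp [stdVec, Finset.sum_sub_distrib]
    | zero => simp
    | add x y _ _ hx hy => simp [Finset.sum_add_distrib, hx, hy]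
    | smul c x _ hx => simp [← Finset.mul_sum, hx]
  · intro hx
    rcases isEmpty_or_nonempty (Fin m) with _ | ⟨⟨a⟩⟩
    · rw [Subsingleton.elim x 0]
      exact Submodule.zero_mem _
    · have key : x = ∑ i, x i • (stdVec k m i - stdVec k m a) := by
        ext j
        simp only [Finset.sum_apply, Pi.smul_apply, Pi.sub_apply, smul_eq_mul, mul_sub,
          Finset.sum_sub_distrib, ← Finset.sum_mul, hx, zero_mul, sub_zero]
        simp [stdVec, Pi.single_apply]
      rw [key]
      exact Submodule.sum_mem _ fun i _ => Submodule.smul_mem _ _ (stdVec_sub_mem k m i a)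

lemma finrank_Vtil_add_one (hm : 0 < m) : Module.finrank k (Vtil k m) + 1 = m := by
  let s : (Fin m → k) →ₗ[k] k := ∑ i, LinearMap.proj i
  have hs : ∀ x, s x = ∑ i, x i := fun x => by simp [s]
  have hker : Vtil k m = LinearMap.ker s := by
    ext x
    rw [mem_Vtil_iff, LinearMap.mem_ker, hs]
  have hsurj : Function.Surjective s := fun c =>
    ⟨Pi.single ⟨0, hm⟩ c, by simp [hs]⟩
  have h := s.finrank_range_add_finrank_ker
  rw [LinearMap.range_eq_top.2 hsurj, finrank_top, Module.finrank_self,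
    Module.finrank_fin_fun, ← hker] at h
  omega

lemma vvec_mem_Vtil (hm : (m : k) = 0) : vvec k m ∈ Vtil k m := by
  simp [mem_Vtil_iff, vvec_apply, hm]

lemma Zv_eq_span_singleton (hm : (m : k) = 0) :
    Zv k m = Submodule.span k {⟨vvec k m, vvec_mem_Vtil hm⟩} := by
  unfold Zv
  congr 1
  ext x
  simp [Subtype.ext_iff]

lemma mem_Zv_iff (hm : (m : k) = 0) (x : Vtil k m) :
    x ∈ Zv k m ↔ ∃ c : k, ∀ i, (x : Fin m → k) i = c := by
  rw [Zv_eq_span_singleton hm, Submodule.mem_span_singleton]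
  refine exists_congr fun c => ?_
  rw [Subtype.ext_iff, funext_iff]
  simp [vvec_apply, eq_comm]

lemma finrank_Vquot_add_two (hm : (m : k) = 0) (hpos : 0 < m) :
    Module.finrank k (Vquot k m) + 2 = m := by
  have h := (Zv k m).finrank_quotient_add_finrank
  have hne : (⟨vvec k m, vvec_mem_Vtil hm⟩ : Vtil k m) ≠ 0 := by
    intro h0
    have := congrFun (congrArg Subtype.val h0) ⟨0, hpos⟩
    simp [vvec_apply] at this
  have hZ : Module.finrank k (Zv k m) = 1 := by
    rw [Zv_eq_span_singleton hm]
    exact finrank_span_singleton hne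
  have hV := finrank_Vtil_add_one (k := k) hpos
  change Module.finrank k (Vquot k m) + _ = _ at h
  omega

lemma rho_mkQ_eq_iff (hm : (m : k) = 0) (τ : Equiv.Perm (Fin m)) (x : Vtil k m) :
    rho k m τ ((Zv k m).mkQ x) = (Zv k m).mkQ x ↔
      ∃ c : k, ∀ i, (x : Fin m → k) i = (x : Fin m → k) (τ i) + c := by
  rw [rho, Submodule.mkQ_apply, Submodule.mapQ_apply, Submodule.Quotient.eq, mem_Zv_iff hm]
  refine exists_congr fun c => ?_
  rw [← τ.forall_congr_right]
  simp [permT_apply, sub_eq_iff_eq_add, add_comm]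

end Quotient

section Blocks

variable {p m' : ℕ} {k : Type} [Field k]

/-- The index of the block containing `i`. -/
def blockIdx (i : Fin (p * m')) : Fin m' :=
  ⟨(i : ℕ) / p, Nat.div_lt_of_lt_mul i.isLt⟩

lemma vj_apply (hp : 0 < p) (j : Fin m') (i : Fin (p * m')) :
    vj k p m' j i = if blockIdx i = j then 1 else 0 := by
  simp only [vj, stdVec, Finset.sum_apply, Pi.single_apply, Fin.ext_iff, blockIdx]
  split_ifs with h
  · rw [Finset.sum_eq_single ⟨i % p, Nat.mod_lt _ hp⟩]
    · rw [if_pos]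
      rw [← h, Nat.div_add_mod]
    · intro b _ hb
      rw [if_neg]
      intro hi
      apply hb
      ext
      simp [hi, Nat.mod_eq_of_lt b.isLt]
    · simp
  · refine Finset.sum_eq_zero fun b _ => if_neg fun hi => h ?_
    rw [hi, Nat.mul_add_div hp, Nat.div_eq_of_lt b.isLt, add_zero]

lemma blockCycle_val (i : Fin (p * m')) :
    ∃ r : Fin p, (r : ℕ) = i % p ∧
      (blockCycle p m' i : ℕ) = finRotate p r + p * (i / p) := by
  have hp : 0 < p := Nat.pos_of_ne_zero fun h => by
    have := i.isLt
    simp [h] at this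
  exact ⟨⟨i % p, Nat.mod_lt _ hp⟩, rfl, by
    simp [blockCycle, Equiv.permCongr_apply, finProdFinEquiv, Fin.divNat, Fin.modNat]⟩

lemma blockIdx_blockCycle (i : Fin (p * m')) : blockIdx (blockCycle p m' i) = blockIdx i := by
  obtain ⟨r, _, h⟩ := blockCycle_val i
  have hp : 0 < p := r.pos
  ext
  simp [blockIdx, h, Nat.add_mul_div_left _ _ hp]

variable [CharP k p]

lemma cast_blockCycle (i : Fin (p * m')) :
    ((blockCycle p m' i : ℕ) : k) = (i : ℕ) + 1 := by
  obtain ⟨r, hr, h⟩ := blockCycle_val i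
  have hi : ((i : ℕ) : k) = (r : ℕ) := by
    rw [hr, ← CharP.cast_eq_mod k p]
  have hrot : ((finRotate p r : ℕ) : k) = (r : ℕ) + 1 := by
    obtain ⟨n, rfl⟩ := Nat.exists_eq_succ_of_ne_zero r.pos.ne'
    by_cases hn : r = Fin.last n
    · subst hn
      rw [finRotate_last]
      have := CharP.cast_eq_zero k (n + 1)
      push_cast at this
      simpa using this.symm
    · rw [coe_finRotate_of_ne_last hn]
      push_cast
      rfl
  rw [h]
  push_cast
  rw [hrot, hi, CharP.cast_eq_zero k p, zero_mul, add_zero]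

lemma blockIdx_blockCycle_pow (l : ℕ) (i : Fin (p * m')) :
    blockIdx ((blockCycle p m' ^ l) i) = blockIdx i := by
  induction l with
  | zero => simp
  | succ l ih => rw [pow_succ', Equiv.Perm.mul_apply, blockIdx_blockCycle, ih]

lemma cast_blockCycle_pow (l : ℕ) (i : Fin (p * m')) :
    (((blockCycle p m' ^ l) i : ℕ) : k) = (i : ℕ) + l := by
  induction l with
  | zero => simp
  | succ l ih =>
    rw [pow_succ', Equiv.Perm.mul_apply, cast_blockCycle, ih]
    push_cast
    ring

variable (k) in
/-- An index is determined by its block and its residue in `k`. -/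
lemma eq_of_blockIdx_eq_of_cast_eq {i j : Fin (p * m')} (hb : blockIdx i = blockIdx j)
    (hc : ((i : ℕ) : k) = (j : ℕ)) : i = j := by
  have hmod : (i : ℕ) % p = j % p := (CharP.natCast_eq_natCast k p).1 hc
  have hdiv : (i : ℕ) / p = j / p := congrArg Fin.val hb
  ext
  rw [← Nat.div_add_mod (i : ℕ) p, ← Nat.div_add_mod (j : ℕ) p, hmod, hdiv]

lemma orderOf_blockCycle [Fact p.Prime] (hm' : 0 < m') : orderOf (blockCycle p m') = p := by
  refine orderOf_eq_prime ?_ fun h => ?_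
  · ext1 i
    refine eq_of_blockIdx_eq_of_cast_eq (ZMod p) (blockIdx_blockCycle_pow p i) ?_
    simp [cast_blockCycle_pow]
  · have hpos : 0 < p * m' := Nat.mul_pos (Fact.out : p.Prime).pos hm'
    have := cast_blockCycle (k := ZMod p) (⟨0, hpos⟩ : Fin (p * m'))
    simp [h] at this

lemma natCast_mul_block_eq_zero : ((p * m' : ℕ) : k) = 0 := by
  simp

lemma vj_mem_Vtil (j : Fin m') : vj k p m' j ∈ Vtil k (p * m') := by
  rw [mem_Vtil_iff]
  simp only [vj, stdVec, Finset.sum_apply]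
  rw [Finset.sum_comm]
  simp

lemma wvec_mem_Vtil (hpm : Odd p ∨ (p = 2 ∧ Even m')) :
    wvec k (p * m') ∈ Vtil k (p * m') := by
  rw [mem_Vtil_iff]
  simp only [wvec_apply]
  have hsum : ∑ i : Fin (p * m'), (((i : ℕ) : k) + 1)
      = ((∑ i ∈ Finset.range (p * m' + 1), i : ℕ) : k) := by
    rw [Finset.sum_range_succ', Finset.sum_range]
    push_cast
    simp
  rw [hsum, CharP.cast_eq_zero_iff k p]
  have h2 := Finset.sum_range_id_mul_two (p * m' + 1)
  rw [Nat.add_sub_cancel] at h2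
  rcases hpm with hp | ⟨rfl, n, rfl⟩
  · refine (Nat.Coprime.dvd_of_dvd_mul_right (Nat.coprime_two_right.2 hp) ?_)
    rw [h2]
    exact ⟨(p * m' + 1) * m', by ring⟩
  · exact ⟨(2 * (n + n) + 1) * n, by linarith⟩

variable (k) in
/-- The map `(f, a) ↦ Σ f_j v_j + a w` to `Ṽ`. -/
def blockParam (hpm : Odd p ∨ (p = 2 ∧ Even m')) :
    ((Fin m' → k) × k) →ₗ[k] Vtil k (p * m') :=
  (Fintype.linearCombination k fun j => (⟨vj k p m' j, vj_mem_Vtil j⟩ : Vtil k (p * m'))).coprod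
    (LinearMap.toSpanSingleton k _ ⟨wvec k (p * m'), wvec_mem_Vtil hpm⟩)

lemma blockParam_apply (hp : 0 < p) (hpm : Odd p ∨ (p = 2 ∧ Even m')) (f : Fin m' → k) (a : k)
    (i : Fin (p * m')) :
    (blockParam k hpm (f, a) : Fin (p * m') → k) i
      = f (blockIdx i) + a * ((i : ℕ) + 1) := by
  simp [blockParam, Fintype.linearCombination_apply, vj_apply hp, wvec_apply]

lemma Usub_eq_range (hpm : Odd p ∨ (p = 2 ∧ Even m')) :
    Usub k p m' = LinearMap.range ((Zv k (p * m')).mkQ ∘ₗ blockParam k hpm) := by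
  rw [LinearMap.range_comp, Usub]
  congr 1
  rw [blockParam, LinearMap.range_coprod, Fintype.range_linearCombination,
    LinearMap.range_toSpanSingleton, ← Submodule.span_union]
  congr 1
  ext x
  simp [Subtype.ext_iff, eq_comm, or_comm]

lemma finrank_Usub [Fact p.Prime] (hm' : 0 < m') (hpm : Odd p ∨ (p = 2 ∧ Even m')) :
    Module.finrank k (Usub k p m') = m' := by
  have hp : p.Prime := Fact.out
  have h := LinearMap.finrank_range_add_finrank_ker
    ((Zv k (p * m')).mkQ ∘ₗ blockParam k hpm)
  rw [← Usub_eq_range hpm] at h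
  have hker : LinearMap.ker ((Zv k (p * m')).mkQ ∘ₗ blockParam k hpm)
      = Submodule.span k {((fun _ => 1, 0) : (Fin m' → k) × k)} := by
    ext ⟨f, a⟩
    rw [LinearMap.mem_ker, LinearMap.comp_apply, Submodule.mkQ_apply,
      Submodule.Quotient.mk_eq_zero, mem_Zv_iff natCast_mul_block_eq_zero,
      Submodule.mem_span_singleton]
    refine exists_congr fun c => ?_
    simp only [blockParam_apply hp.pos]
    constructor
    · intro hc
      have ha : a = 0 := by
        have hpos : 0 < p * m' := Nat.mul_pos hp.pos hm'
        have h0 := hc ⟨0, hpos⟩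
        have h1 := hc (blockCycle p m' ⟨0, hpos⟩)
        rw [blockIdx_blockCycle, cast_blockCycle] at h1
        linear_combination h1 - h0
      subst ha
      ext j
      · have hlt : p * (j : ℕ) < p * m' := Nat.mul_lt_mul_of_pos_left j.isLt hp.pos
        have hj := hc ⟨p * j, hlt⟩
        have hidx : blockIdx (⟨p * j, hlt⟩ : Fin (p * m')) = j := by
          ext
          simp [blockIdx, hp.pos]
        rw [hidx] at hj
        simpa using hj.symm
      · simp
    · intro hc i
      rw [Prod.ext_iff, funext_iff] at hc
      obtain ⟨hf, ha⟩ := hc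
      have hfi := hf (blockIdx i)
      simp at hfi ha
      simp [← hfi, ← ha]
  have hne : ((fun _ => 1, 0) : (Fin m' → k) × k) ≠ 0 := by
    intro h0
    have := congrFun (congrArg Prod.fst h0) ⟨0, hm'⟩
    simp at this
  rw [hker, finrank_span_singleton hne] at h
  simpa using h

lemma rho_blockCycle_pow_eq_of_mem_Usub (hp : 0 < p) (hpm : Odd p ∨ (p = 2 ∧ Even m')) (l : ℕ)
    {x : Vquot k (p * m')} (hx : x ∈ Usub k p m') :
    rho k (p * m') (blockCycle p m' ^ l) x = x := by
  rw [Usub_eq_range hpm] at hx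
  obtain ⟨⟨f, a⟩, rfl⟩ := hx
  rw [LinearMap.comp_apply, rho_mkQ_eq_iff natCast_mul_block_eq_zero]
  refine ⟨-(a * l), fun i => ?_⟩
  rw [blockParam_apply hp, blockParam_apply hp, blockIdx_blockCycle_pow,
    cast_blockCycle_pow]
  ring

lemma mem_Usub_of_rho_blockCycle_eq (hp : 0 < p) (hpm : Odd p ∨ (p = 2 ∧ Even m'))
    {x : Vquot k (p * m')} (hx : rho k (p * m') (blockCycle p m') x = x) :
    x ∈ Usub k p m' := by
  obtain ⟨y, rfl⟩ := Submodule.mkQ_surjective _ x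
  obtain ⟨c, hc⟩ := (rho_mkQ_eq_iff natCast_mul_block_eq_zero _ _).1 hx
  have hpow : ∀ (l : ℕ) (i : Fin (p * m')), (y : Fin (p * m') → k) i
      = (y : Fin (p * m') → k) ((blockCycle p m' ^ l) i) + l * c := by
    intro l i
    induction l with
    | zero => simp
    | succ l ih =>
      rw [ih, hc, pow_succ', Equiv.Perm.mul_apply]
      push_cast
      ring
  have hlt : ∀ j : Fin m', p * (j : ℕ) < p * m' := fun j =>
    Nat.mul_lt_mul_of_pos_left j.isLt hp
  rw [Usub_eq_range hpm]
  refine ⟨(fun j => (y : Fin (p * m') → k) ⟨p * j, hlt j⟩ + c, -c), ?_⟩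
  rw [LinearMap.comp_apply]
  congr 1
  ext i
  rw [blockParam_apply hp, hpow (i : ℕ) ⟨p * blockIdx i, hlt _⟩]
  have hi : (blockCycle p m' ^ (i : ℕ)) ⟨p * blockIdx i, hlt _⟩ = i := by
    apply eq_of_blockIdx_eq_of_cast_eq k
    · rw [blockIdx_blockCycle_pow]
      ext
      simp [blockIdx, hp]
    · rw [cast_blockCycle_pow]
      simp
  rw [hi]
  ring

lemma card_filter_blockIdx_le (hp : 0 < p) (j : Fin m') :
    (Finset.univ.filter fun i : Fin (p * m') => blockIdx i = j).card ≤ p := by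
  calc _ ≤ (Finset.univ : Finset (Fin p)).card := by
        refine Finset.card_le_card_of_injOn (fun i => ⟨i % p, Nat.mod_lt _ hp⟩)
          (fun _ _ => Finset.mem_coe.2 (Finset.mem_univ _)) ?_
        intro a ha b hb hab
        have ha' : blockIdx a = j := by simpa using ha
        have hb' : blockIdx b = j := by simpa using hb
        have hdiv : (a : ℕ) / p = b / p := congrArg Fin.val (ha'.trans hb'.symm)
        have hmod : (a : ℕ) % p = b % p := congrArg Fin.val hab
        ext
        rw [← Nat.div_add_mod (a : ℕ) p, ← Nat.div_add_mod (b : ℕ) p, hmod, hdiv]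
    _ = p := by simp

/-- A permutation fixing the classes of all `v_j` preserves each block. -/
lemma blockIdx_eq_of_fixes_vj [Fact p.Prime] (hm : 5 ≤ p * m') (τ : Equiv.Perm (Fin (p * m')))
    (hτ : ∀ j : Fin m', ∃ c : k, ∀ i, vj k p m' j i = vj k p m' j (τ i) + c)
    (i : Fin (p * m')) : blockIdx (τ i) = blockIdx i := by
  have hp : p.Prime := Fact.out
  by_contra hne
  obtain ⟨c, hc⟩ := hτ (blockIdx i)
  simp only [vj_apply hp.pos] at hc
  have hc1 : c = 1 := by simpa [hne] using (hc i).symm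
  subst hc1
  have hout : ∀ a, blockIdx a ≠ blockIdx i → blockIdx (τ a) = blockIdx i := by
    intro a ha
    by_contra hτa
    simpa [ha, hτa] using hc a
  have hcard := Finset.card_filter_add_card_filter_not
    (s := (Finset.univ : Finset (Fin (p * m')))) (fun a => blockIdx a = blockIdx i)
  have hle : (Finset.univ.filter fun a : Fin (p * m') => ¬ blockIdx a = blockIdx i).card
      ≤ (Finset.univ.filter fun a : Fin (p * m') => blockIdx a = blockIdx i).card := by
    refine Finset.card_le_card_of_injOn τ (fun a ha => ?_) τ.injective.injOn
    simpa using hout a (by simpa using ha)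
  have hblock := card_filter_blockIdx_le hp.pos (blockIdx i)
  have htwo := hc (τ i)
  have hp2 : p = 2 := by
    have h20 : ((2 : ℕ) : k) = 0 := by
      simp only [hne, if_false] at htwo
      split_ifs at htwo
      · push_cast
        linear_combination -htwo
      · simp at htwo
    exact (Nat.prime_dvd_prime_iff_eq hp Nat.prime_two).1 ((CharP.cast_eq_zero_iff k p 2).1 h20)
  rw [Finset.card_univ, Fintype.card_fin] at hcard
  omega

lemma exists_eq_blockCycle_pow [Fact p.Prime] (hm : 5 ≤ p * m')
    (hpm : Odd p ∨ (p = 2 ∧ Even m')) (τ : Equiv.Perm (Fin (p * m')))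
    (hτ : ∀ x ∈ Usub k p m', rho k (p * m') τ x = x) :
    ∃ l : ℕ, τ = blockCycle p m' ^ l := by
  have hgen : ∀ y : Vtil k (p * m'), ((∃ j : Fin m', (y : Fin (p * m') → k) = vj k p m' j) ∨
      (y : Fin (p * m') → k) = wvec k (p * m')) →
      ∃ c : k, ∀ i, (y : Fin (p * m') → k) i = (y : Fin (p * m') → k) (τ i) + c := fun y hy =>
    (rho_mkQ_eq_iff natCast_mul_block_eq_zero τ y).1
      (hτ _ (Submodule.mem_map_of_mem (Submodule.subset_span hy)))
  have hblock := blockIdx_eq_of_fixes_vj hm τ fun j =>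
    hgen ⟨vj k p m' j, vj_mem_Vtil j⟩ (Or.inl ⟨j, rfl⟩)
  obtain ⟨c, hc⟩ := hgen ⟨wvec k (p * m'), wvec_mem_Vtil hpm⟩ (Or.inr rfl)
  simp only [wvec_apply] at hc
  refine ⟨(τ ⟨0, by omega⟩ : ℕ), Equiv.ext fun i => eq_of_blockIdx_eq_of_cast_eq k ?_ ?_⟩
  · rw [hblock, blockIdx_blockCycle_pow]
  · rw [cast_blockCycle_pow]
    have h0 := hc ⟨0, by omega⟩
    simp only [Nat.cast_zero] at h0
    linear_combination h0 - hc i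

end Blocks

lemma three_lt_pred_mul {p m' : ℕ} (hp : p.Prime) (hm : 5 ≤ p * m')
    (hpm : Odd p ∨ (p = 2 ∧ Even m')) : 3 < (p - 1) * m' := by
  rcases hpm with hodd | ⟨rfl, n, rfl⟩
  · obtain ⟨n, rfl⟩ := hodd
    have hn : 0 < n := Nat.pos_of_ne_zero fun h => by simp [h, Nat.not_prime_one] at hp
    rw [Nat.add_sub_cancel]
    by_contra! h
    have hnm : n * m' ≤ 1 := by nlinarith
    nlinarith
  · omega

/-- For `m = pm' ≥ 5`, `char k = p`, and `p` odd or `p = 2` with `m'` even: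
the point stabilizer of `U` in `S_m` acting on `V = Ṽ/⟨v⟩` is the cyclic group
`⟨σ⟩` of order `p`, the fixed-point space of `σ` on `V` equals `U`, and `U`
has codimension `(p-1)m' - 2 > 1` in `V`, so `σ` is not a pseudo-reflection. -/
theorem pointStabilizer_U_eq_cyclic
    (k : Type) [Field k] (p : ℕ) [Fact p.Prime] [CharP k p]
    (m' : ℕ) (hm : 5 ≤ p * m')
    (hpm : Odd p ∨ (p = 2 ∧ Even m')) :
    {τ : Equiv.Perm (Fin (p * m')) |
        ∀ x ∈ Usub k p m', rho k (p * m') τ x = x} =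
      {τ : Equiv.Perm (Fin (p * m')) | ∃ l : ℕ, τ = blockCycle p m' ^ l} ∧
    orderOf (blockCycle p m') = p ∧
    (∀ x : Vquot k (p * m'),
      rho k (p * m') (blockCycle p m') x = x ↔ x ∈ Usub k p m') ∧
    Module.finrank k (Usub k p m') + ((p - 1) * m' - 2) =
      Module.finrank k (Vquot k (p * m')) ∧
    1 < (p - 1) * m' - 2 ∧
    Module.finrank k (Usub k p m') + 1 ≠ Module.finrank k (Vquot k (p * m')) := by
  have hp : p.Prime := Fact.out
  have hm' : 0 < m' := Nat.pos_of_ne_zero fun h => by simp [h] at hm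
  have hcodim := three_lt_pred_mul hp hm hpm
  have hU := finrank_Usub (k := k) hm' hpm
  have hV := finrank_Vquot_add_two (k := k) (m := p * m') natCast_mul_block_eq_zero (by omega)
  have hmul : (p - 1) * m' + m' = p * m' := by
    rw [← Nat.succ_mul, Nat.succ_eq_add_one, Nat.sub_add_cancel hp.one_le]
  refine ⟨?_, orderOf_blockCycle hm', fun x => ⟨mem_Usub_of_rho_blockCycle_eq hp.pos hpm,
    fun hx => ?_⟩, by omega, by omega, by omega⟩
  · ext τ
    refine ⟨exists_eq_blockCycle_pow hm hpm τ, ?_⟩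
    rintro ⟨l, rfl⟩ x hx
    exact rho_blockCycle_pow_eq_of_mem_Usub hp.pos hpm l hx
  · simpa using rho_blockCycle_pow_eq_of_mem_Usub hp.pos hpm 1 hx
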